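/- There is no function h from the set of binary strings of length at most 2 to ^{<ω}2 such that: (1) for every binary string η of length 2 and all i < j ≤ 2, the strings h(η↾i) and h(η↾j) are either equal or incomparable; and (2) for all binary strings η, ν of length at most 2 with η ⊥ ν, one has h(η) ≠ h(ν) and h(η), h(ν) are comparable (h(η) ⊴ h(ν) or h(ν) ⊴ h(η)). (Combinatorial content of Remark 4.10(i): the parameters of an antichain tree cannot be rearranged into a witness of the SOP₂ configuration of height 2.) -/

import Mathlib

/-- The meet `η ∧ ν` of two finite binary strings: their longest common prefix. -/
def lcp : List Bool → List Bool → List Bool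
  | a :: as, b :: bs => if a = b then a :: lcp as bs else []
  | _, _ => []

/-- `η ⊥ ν`: the strings are incomparable (neither is a prefix of the other). -/
def Incomp (a b : List Bool) : Prop := ¬ a <+: b ∧ ¬ b <+: a

/-- A tuple of strings is ∧-closed if the meet of any two entries is again an entry. -/
def MeetClosed {ι : Type*} (t : ι → List Bool) : Prop :=
  ∀ i j : ι, ∃ k : ι, lcp (t i) (t j) = t k

/-- `s ≈_α t`: both tuples are ∧-closed, and they satisfy the same
`⊴`-relations and the same `⌢⟨d⟩⊴`-relations between entries. -/
def EqvA {ι : Type*} (s t : ι → List Bool) : Prop :=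
  MeetClosed s ∧ MeetClosed t ∧
  (∀ i j : ι, s i <+: s j ↔ t i <+: t j) ∧
  (∀ (i j : ι) (d : Bool), s i ++ [d] <+: s j ↔ t i ++ [d] <+: t j)

/-- `s ≈_β t`: `≈_α` together with preservation of the relation `ηᵢ⌢⟨1⟩ = ηⱼ`. -/
def EqvB {ι : Type*} (s t : ι → List Bool) : Prop :=
  EqvA s t ∧ ∀ i j : ι, s i ++ [true] = s j ↔ t i ++ [true] = t j

/-- `s ≈_γ t`: `≈_β` together with preservation of `ηᵢ⌢⟨0⟩ = ηⱼ` and of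
ending with `0` resp. with `1`. -/
def EqvG {ι : Type*} (s t : ι → List Bool) : Prop :=
  EqvB s t ∧
  (∀ i j : ι, s i ++ [false] = s j ↔ t i ++ [false] = t j) ∧
  (∀ i : ι, (s i).getLast? = some false ↔ (t i).getLast? = some false) ∧
  (∀ i : ι, (s i).getLast? = some true ↔ (t i).getLast? = some true)

/-- The meet-closure tuple of a tuple of strings: all pairwise meets. -/
def cl {ι : Type*} (t : ι → List Bool) : ι × ι → List Bool :=
  fun p => lcp (t p.1) (t p.2)

theorem prefix_of_comparable_of_incomp {x y z : List Bool} (hxy : x <+: y ∨ y <+: x)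
    (hyz : y <+: z ∨ z <+: y) (hxz : Incomp x z) : y <+: x := by
  rcases hxy with hxy | hyx
  · rcases hyz with hyz | hzy
    · exact absurd (hxy.trans hyz) hxz.1
    · exact absurd (List.prefix_or_prefix_of_prefix hxy hzy) (not_or.mpr hxz)
  · exact hyx

theorem incomp_of_eq_or_incomp {x u v : List Bool} (hu : x = u ∨ Incomp x u)
    (hv : x = v ∨ Incomp x v) (hne : u ≠ v) (huv : u <+: v ∨ v <+: u) : Incomp x u := by
  rcases hu with rfl | hu
  · exact absurd huv (not_or.mpr (hv.resolve_left hne))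
  · exact hu

/-- Remark 4.10(i), combinatorial content: there is no map `h` on binary
strings of length at most 2 sending chains to (equal-or-)incomparable pairs
while sending incomparable pairs to distinct comparable strings. -/
theorem stmt15 :
    ¬ ∃ h : List Bool → List Bool,
      (∀ η : List Bool, η.length = 2 → ∀ i j : ℕ, i < j → j ≤ 2 →
        (h (η.take i) = h (η.take j) ∨ Incomp (h (η.take i)) (h (η.take j)))) ∧
      (∀ η ν : List Bool, η.length ≤ 2 → ν.length ≤ 2 → Incomp η ν →
        h η ≠ h ν ∧ (h η <+: h ν ∨ h ν <+: h η)) := by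
  rintro ⟨h, chain, incomp⟩
  have comparable : ∀ a b c : Bool, a ≠ b →
      h [a] <+: h [b, c] ∨ h [b, c] <+: h [a] := fun a b c hab =>
    (incomp [a] [b, c] (by simp) (by simp) (by simp [Incomp, hab])).2
  have child : ∀ a : Bool, Incomp (h [a]) (h [a, false]) := by
    intro a
    obtain ⟨hne, hcomp⟩ := incomp [a, false] [a, true] (by simp) (by simp) (by simp [Incomp])
    exact incomp_of_eq_or_incomp
      (by simpa using chain [a, false] rfl 1 2 (by simp) le_rfl)
      (by simpa using chain [a, true] rfl 1 2 (by simp) le_rfl) hne hcomp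
  obtain ⟨hne, hcomp⟩ := incomp [false] [true] (by simp) (by simp) (by simp [Incomp])
  have htf : h [true] <+: h [false] :=
    prefix_of_comparable_of_incomp hcomp (comparable true false false (by simp)) (child false)
  have hft : h [false] <+: h [true] :=
    prefix_of_comparable_of_incomp hcomp.symm (comparable false true false (by simp)) (child true)
  exact hne (hft.eq_of_length_le htf.length_le)
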